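/- arXiv:1209.4014 — 3 statements merged into one kernel-verified Lean document; each statement's English description precedes it below -/
import Mathlib

section
/- Let n ≥ 2 and let z_0, z_1, …, z_n ∈ ℂ be nondegenerate. Then the set of families c = (c_{ij})_{1≤i<j≤n} of complex numbers satisfying, for every natural number k, Σ_{1≤i<j≤n} c_{ij} · ∫_{convexHull ℝ {z_0,z_i,z_j}} w^k dvolume(w) = 0, is a ℂ-linear subspace of ℂ^{C(n,2)} of dimension (n−1)(n−2)/2 (= C(n−1,2)). -/
open MeasureTheory

/-- A tuple of points in `ℂ` is nondegenerate if the points are pairwise distinct and no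
three of them are collinear over `ℝ`. -/
def Nondegenerate {m : ℕ} (z : Fin m → ℂ) : Prop :=
  Function.Injective z ∧
    ∀ i j k : Fin m, i ≠ j → i ≠ k → j ≠ k → ¬Collinear ℝ ({z i, z j, z k} : Set ℂ)

/-- The index type of pairs `(i, j)` with `1 ≤ i < j ≤ n`; it has cardinality `C(n,2)`. -/
def PairIdx (n : ℕ) : Type :=
  {p : Fin (n + 1) × Fin (n + 1) // 0 < (p.1 : ℕ) ∧ (p.1 : ℕ) < (p.2 : ℕ)}

instance (n : ℕ) : Fintype (PairIdx n) := by
  unfold PairIdx; infer_instance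



theorem mem_tri (a u v : ℂ) (s t : ℝ) (hinj : ∀ s t : ℝ, (s : ℂ) * u + t * v = 0 → s = 0 ∧ t = 0) :
    a + (s * u + t * v) ∈ convexHull ℝ ({a, a + u, a + v} : Set ℂ) ↔ 0 ≤ s ∧ 0 ≤ t ∧ s + t ≤ 1 := by
  constructor
  · intro h
    have hK : convexHull ℝ ({a, a + u, a + v} : Set ℂ) ⊆
        {w | ∃ s t : ℝ, 0 ≤ s ∧ 0 ≤ t ∧ s + t ≤ 1 ∧ w = a + (s * u + t * v)} := by
      apply convexHull_min
      · rintro w (rfl | rfl | rfl)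
        · exact ⟨0, 0, by simp⟩
        · exact ⟨1, 0, by simp⟩
        · exact ⟨0, 1, by simp⟩
      · rintro x ⟨s, t, hs, ht, hst, rfl⟩ y ⟨s', t', hs', ht', hst', rfl⟩ p q hp hq hpq
        refine ⟨p * s + q * s', p * t + q * t', by positivity, by positivity, by nlinarith, ?_⟩
        have : (p : ℂ) + q = 1 := by exact_mod_cast hpq
        simp only [Complex.real_smul]
        push_cast
        linear_combination a * this
    obtain ⟨s', t', hs, ht, hst, e⟩ := hK h
    obtain ⟨h1, h2⟩ := hinj (s - s') (t - t') (by push_cast; linear_combination e)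
    obtain rfl : s = s' := by linarith
    obtain rfl : t = t' := by linarith
    exact ⟨hs, ht, hst⟩
  · rintro ⟨hs, ht, hst⟩
    have := (convex_convexHull ℝ ({a, a + u, a + v} : Set ℂ)).sum_mem (t := Finset.univ)
      (w := ![1 - s - t, s, t]) (z := ![a, a + u, a + v])
      (by intro i _; fin_cases i <;> simp <;> linarith)
      (by simp [Fin.sum_univ_three]; ring)
      (by intro i _; apply subset_convexHull; fin_cases i <;> simp)
    rw [Fin.sum_univ_three] at this
    convert this using 1
    simp
    ring

theorem simplex_int (a u v : ℂ) (hu : u ≠ 0) (hv : v ≠ 0) (huv : u ≠ v) (k : ℕ) :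
    ((k : ℂ) + 1) * (k + 2) *
      ∫ p in {p : ℝ × ℝ | 0 ≤ p.1 ∧ 0 ≤ p.2 ∧ p.1 + p.2 ≤ 1}, (a + (p.1 * u + p.2 * v)) ^ k =
    ((a + u) ^ (k + 2) - (a + v) ^ (k + 2)) / (v * (u - v)) -
      ((a + u) ^ (k + 2) - a ^ (k + 2)) / (v * u) := by
  set S := {p : ℝ × ℝ | 0 ≤ p.1 ∧ 0 ≤ p.2 ∧ p.1 + p.2 ≤ 1} with hS
  have hSc : IsClosed S := by
    apply IsClosed.and (isClosed_le (by fun_prop) (by fun_prop))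
    exact IsClosed.and (isClosed_le (by fun_prop) (by fun_prop)) (isClosed_le (by fun_prop) (by fun_prop))
  have hScomp : IsCompact S := by
    apply (isCompact_Icc (a := ((0 : ℝ), (0 : ℝ))) (b := (1, 1))).of_isClosed_subset hSc
    rintro ⟨s, t⟩ ⟨h1, h2, h3⟩
    simp only at h1 h2 h3
    exact ⟨⟨h1, h2⟩, ⟨by simp; linarith, by simp; linarith⟩⟩
  have hint : IntegrableOn (fun p : ℝ × ℝ => (a + (p.1 * u + p.2 * v)) ^ k) S :=
    (Continuous.continuousOn (by fun_prop)).integrableOn_compact hScomp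
  -- antiderivative
  have hA : ∀ (b d : ℂ) (_ : d ≠ 0) (e : ℕ) (x y : ℝ), ∫ t in x..y, (b + t * d) ^ e =
      ((b + y * d) ^ (e + 1) - (b + x * d) ^ (e + 1)) / ((e + 1) * d) := by
    intro b d hd e x y
    have he : (e : ℂ) + 1 ≠ 0 := by norm_cast
    rw [intervalIntegral.integral_eq_sub_of_hasDerivAt
      (f := fun t : ℝ => (b + t * d) ^ (e + 1) / ((e + 1) * d))]
    · ring
    · intro t _
      have h1 : HasDerivAt (fun t : ℝ => b + (t : ℂ) * d) d t := by
        simpa using (((Complex.ofRealCLM.hasDerivAt (x := t)).mul_const d).const_add b)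
      have h2 := (h1.pow (e + 1)).div_const ((e + 1) * d)
      have h3 : (b + (t : ℂ) * d) ^ e =
          ((e + 1 : ℕ) : ℂ) * (b + (t : ℂ) * d) ^ (e + 1 - 1) * d / ((e + 1) * d) := by
        push_cast
        field_simp
      rw [h3]
      exact h2
    · apply Continuous.intervalIntegrable
      fun_prop
  rw [← integral_indicator hSc.measurableSet, Measure.volume_eq_prod, integral_prod]
  swap
  · rw [← Measure.volume_eq_prod]; exact hint.integrable_indicator hSc.measurableSet
  have inner : ∀ s : ℝ, ∫ t : ℝ, S.indicator (fun p : ℝ × ℝ => (a + (p.1 * u + p.2 * v)) ^ k) (s, t)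
      = (Set.Icc (0 : ℝ) 1).indicator (fun s : ℝ => (((a + v) + s * (u - v)) ^ (k + 1) -
          (a + s * u) ^ (k + 1)) / ((k + 1) * v)) s := by
    intro s
    by_cases hs : s ∈ Set.Icc (0 : ℝ) 1
    · rw [Set.indicator_of_mem hs]
      have : ∀ t : ℝ, S.indicator (fun p : ℝ × ℝ => (a + (p.1 * u + p.2 * v)) ^ k) (s, t) =
          (Set.Icc (0 : ℝ) (1 - s)).indicator (fun t : ℝ => ((a + s * u) + t * v) ^ k) t := by
        intro t
        have hm : (s, t) ∈ S ↔ t ∈ Set.Icc (0 : ℝ) (1 - s) := by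
          simp only [hS, Set.mem_ofPred_eq, Set.mem_Icc]
          constructor
          · rintro ⟨h1, h2, h3⟩; exact ⟨h2, by linarith⟩
          · rintro ⟨h1, h2⟩; exact ⟨hs.1, h1, by linarith⟩
        by_cases h : (s, t) ∈ S
        · rw [Set.indicator_of_mem h, Set.indicator_of_mem (hm.1 h)]; simp only [add_assoc]
        · rw [Set.indicator_of_notMem h, Set.indicator_of_notMem (fun h' => h (hm.2 h'))]
      simp only [this]
      rw [integral_indicator measurableSet_Icc, integral_Icc_eq_integral_Ioc,
        ← intervalIntegral.integral_of_le (by linarith [hs.2]), hA _ _ hv]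
      push_cast
      ring_nf
    · rw [Set.indicator_of_notMem hs]
      have : ∀ t : ℝ, S.indicator (fun p : ℝ × ℝ => (a + (p.1 * u + p.2 * v)) ^ k) (s, t) = 0 := by
        intro t
        apply Set.indicator_of_notMem
        rintro ⟨h1, h2, h3⟩
        simp only at h1 h2 h3
        exact hs ⟨h1, by linarith⟩
      simp [this]
  simp only [inner]
  rw [integral_indicator measurableSet_Icc, integral_Icc_eq_integral_Ioc,
        ← intervalIntegral.integral_of_le zero_le_one, intervalIntegral.integral_div,
        intervalIntegral.integral_sub, hA _ _ (sub_ne_zero.2 huv), hA _ _ hu]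
  · have h1 : (k : ℂ) + 1 ≠ 0 := by norm_cast
    have h2 : (k : ℂ) + 2 ≠ 0 := by norm_cast
    have h3 : (k : ℂ) + 1 + 1 ≠ 0 := by norm_cast
    have h4 := sub_ne_zero.2 huv
    push_cast
    have e1 : (k : ℂ) + 1 + 1 = k + 2 := by ring
    have e2 : a + v + (u - v) = a + u := by ring
    simp only [e1, e2, zero_mul, add_zero, one_mul, show k + 1 + 1 = k + 2 from rfl]
    field_simp
  · apply Continuous.intervalIntegrable; fun_prop
  · apply Continuous.intervalIntegrable; fun_prop

theorem tri_int (a b c : ℂ) (hnc : ¬ Collinear ℝ ({a, b, c} : Set ℂ)) :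
    ∃ C : ℂ, C ≠ 0 ∧ ∀ k : ℕ, ((k : ℂ) + 1) * (k + 2) * ∫ w in convexHull ℝ ({a, b, c} : Set ℂ), w ^ k
      = C * (a ^ (k + 2) / ((a - b) * (a - c)) + b ^ (k + 2) / ((b - a) * (b - c))
        + c ^ (k + 2) / ((c - a) * (c - b))) := by
  obtain ⟨u, rfl⟩ : ∃ u, b = a + u := ⟨b - a, by ring⟩
  obtain ⟨v, rfl⟩ : ∃ v, c = a + v := ⟨c - a, by ring⟩
  have hu : u ≠ 0 := by
    rintro rfl; apply hnc; simpa using collinear_pair ℝ a (a + v)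
  have hv : v ≠ 0 := by
    rintro rfl; apply hnc
    have : ({a, a + u, a + 0} : Set ℂ) = {a, a + u} := by ext; simp; tauto
    rw [this]; exact collinear_pair ℝ _ _
  have huv : u ≠ v := by
    rintro rfl; apply hnc; simpa using collinear_pair ℝ a (a + u)
  have hinj : ∀ s t : ℝ, (s : ℂ) * u + t * v = 0 → s = 0 ∧ t = 0 := by
    intro s t h
    have ht : t = 0 := by
      by_contra ht
      apply hnc
      rw [collinear_iff_of_mem (p₀ := a) (by simp)]
      refine ⟨u, ?_⟩
      have htc : (t : ℂ) ≠ 0 := by exact_mod_cast ht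
      rintro p (rfl | rfl | rfl)
      · exact ⟨0, by simp⟩
      · exact ⟨1, by simp [add_comm]⟩
      · refine ⟨-(s / t), ?_⟩
        simp only [Complex.real_smul, vadd_eq_add]
        push_cast
        field_simp
        linear_combination h
    subst ht
    simpa [hu] using h
  let T0 : ℝ × ℝ →ₗ[ℝ] ℂ :=
    { toFun := fun p => p.1 * u + p.2 * v
      map_add' := fun p q => by simp; ring
      map_smul' := fun r p => by simp; ring }
  have hT0 : Function.Injective T0 := by
    rw [← LinearMap.ker_eq_bot, LinearMap.ker_eq_bot']
    rintro ⟨s, t⟩ h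
    obtain ⟨rfl, rfl⟩ := hinj s t h
    rfl
  let T : (ℝ × ℝ) ≃L[ℝ] ℂ :=
    (LinearEquiv.ofInjectiveOfFinrankEq T0 hT0 (by simp)).toContinuousLinearEquiv
  have hT : ∀ p, T p = p.1 * u + p.2 * v := fun p => rfl
  let μ : Measure ℂ := Measure.map T volume
  have : μ.IsAddHaarMeasure := T.isAddHaarMeasure_map _
  obtain ⟨κ, hκ0, hκ⟩ : ∃ κ : NNReal, κ ≠ 0 ∧ (volume : Measure ℂ) = κ • μ :=
    ⟨_, (Measure.addHaarScalarFactor_pos_of_isAddHaarMeasure volume μ).ne',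
      Measure.isAddLeftInvariant_eq_smul volume μ⟩
  have key : ∀ k : ℕ, ∫ w in convexHull ℝ ({a, a + u, a + v} : Set ℂ), w ^ k = (κ : ℂ) *
      ∫ p in {p : ℝ × ℝ | 0 ≤ p.1 ∧ 0 ≤ p.2 ∧ p.1 + p.2 ≤ 1}, (a + (p.1 * u + p.2 * v)) ^ k := by
    intro k
    set K := convexHull ℝ ({a, a + u, a + v} : Set ℂ) with hK
    have hKm : MeasurableSet K :=
      (Set.Finite.isCompact_convexHull ℝ (by simp)).isClosed.measurableSet
    rw [← integral_indicator hKm, ← integral_add_left_eq_self _ a, hκ, integral_smul_nnreal_measure]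
    have hmap : ∫ x : ℂ, K.indicator (fun w => w ^ k) (a + x) ∂μ =
        ∫ p : ℝ × ℝ, K.indicator (fun w => w ^ k) (a + T p) :=
      (T.toHomeomorph.measurableEmbedding).integral_map _
    have hSc : IsClosed {p : ℝ × ℝ | 0 ≤ p.1 ∧ 0 ≤ p.2 ∧ p.1 + p.2 ≤ 1} := by
      apply IsClosed.and (isClosed_le (by fun_prop) (by fun_prop))
      exact IsClosed.and (isClosed_le (by fun_prop) (by fun_prop))
        (isClosed_le (by fun_prop) (by fun_prop))
    rw [hmap, ← integral_indicator hSc.measurableSet, NNReal.smul_def, Complex.real_smul]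
    congr 2
    ext p
    have hm := mem_tri a u v p.1 p.2 hinj
    rw [hT]
    by_cases h : 0 ≤ p.1 ∧ 0 ≤ p.2 ∧ p.1 + p.2 ≤ 1
    · rw [Set.indicator_of_mem (hm.2 h), Set.indicator_of_mem (by exact h)]
    · rw [Set.indicator_of_notMem (fun h' => h (hm.1 h')), Set.indicator_of_notMem (by exact h)]
  refine ⟨κ, by simpa using hκ0, fun k => ?_⟩
  rw [key, mul_left_comm, simplex_int a u v hu hv huv k]
  have h4 := sub_ne_zero.2 huv
  have e1 : a - (a + u) = -u := by ring
  have e2 : a - (a + v) = -v := by ring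
  have e3 : a + u - (a + v) = u - v := by ring
  have e4 : a + v - (a + u) = -(u - v) := by ring
  simp only [e1, e2, e3, e4, add_sub_cancel_left]
  field_simp
  ring

theorem card_pairIdx (n : ℕ) : Fintype.card (PairIdx n) = n.choose 2 := by
  have h1 : Fintype.card (PairIdx n) =
      Fintype.card {p : Fin (n + 1) × Fin (n + 1) // 0 < (p.1 : ℕ) ∧ (p.1 : ℕ) < (p.2 : ℕ)} :=
    Fintype.card_congr (Equiv.refl _)
  rw [h1, Fintype.card_subtype, Finset.card_filter, Fintype.sum_prod_type_right]
  have h2 : ∀ j : Fin (n + 1),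
      ∑ i : Fin (n + 1), (if 0 < (i : ℕ) ∧ (i : ℕ) < (j : ℕ) then 1 else 0) = (j : ℕ) - 1 := by
    intro j
    rw [← Finset.card_filter]
    have : (Finset.univ.filter fun i : Fin (n + 1) => 0 < (i : ℕ) ∧ (i : ℕ) < (j : ℕ))
        = Finset.Ioo 0 j := by
      ext i
      simp only [Finset.mem_filter, Finset.mem_univ, true_and, Finset.mem_Ioo, Fin.lt_def, Fin.val_zero]
    rw [this, Fin.card_Ioo]
    simp
  simp only [h2]
  rw [Fin.sum_univ_eq_sum_range (fun j => j - 1), Finset.sum_range_succ']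
  simp [Finset.sum_range_id, Nat.choose_two_right]

theorem vander {n : ℕ} (z : Fin (n + 1) → ℂ) (hz : Function.Injective z) (m : Fin (n + 1) → ℂ)
    (h : ∀ e : ℕ, ∑ a, m a * z a ^ e = 0) : m = 0 :=
  Matrix.eq_zero_of_forall_pow_sum_mul_pow_eq_zero hz (fun e => h e)

/-- The linear algebra part. -/
theorem linear_part (n : ℕ) (hn : 2 ≤ n) (z : Fin (n + 1) → ℂ) (hz : Function.Injective z)
    (C : PairIdx n → ℂ) (hC : ∀ p, C p ≠ 0) (I : PairIdx n → ℕ → ℂ)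
    (hI : ∀ p (k : ℕ), ((k : ℂ) + 1) * (k + 2) * I p k = C p *
      (z 0 ^ (k + 2) / ((z 0 - z p.1.1) * (z 0 - z p.1.2))
        + z p.1.1 ^ (k + 2) / ((z p.1.1 - z 0) * (z p.1.1 - z p.1.2))
        + z p.1.2 ^ (k + 2) / ((z p.1.2 - z 0) * (z p.1.2 - z p.1.1)))) :
    ∃ V : Submodule ℂ (PairIdx n → ℂ),
      (V : Set (PairIdx n → ℂ)) = {c | ∀ k : ℕ, ∑ p : PairIdx n, c p * I p k = 0} ∧
      Module.finrank ℂ ↥V = (n - 1).choose 2 := by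
  classical
  have d01 : ∀ p : PairIdx n, z 0 - z p.1.1 ≠ 0 := fun p h => by
    have := hz (sub_eq_zero.1 h); have h2 := p.2.1; rw [← this] at h2; simp at h2
  have d02 : ∀ p : PairIdx n, z 0 - z p.1.2 ≠ 0 := fun p h => by
    have := hz (sub_eq_zero.1 h); have h2 := p.2.2; rw [← this] at h2; simp at h2
  have d12 : ∀ p : PairIdx n, z p.1.1 - z p.1.2 ≠ 0 := fun p h => by
    have := hz (sub_eq_zero.1 h); have h2 := p.2.2; rw [← this] at h2; simp at h2
  have d10 : ∀ p : PairIdx n, z p.1.1 - z 0 ≠ 0 := fun p h => d01 p (by linear_combination -h)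
  have d20 : ∀ p : PairIdx n, z p.1.2 - z 0 ≠ 0 := fun p h => d02 p (by linear_combination -h)
  have d21 : ∀ p : PairIdx n, z p.1.2 - z p.1.1 ≠ 0 := fun p h => d12 p (by linear_combination -h)
  let q : PairIdx n → Fin (n + 1) → ℂ := fun p a =>
    C p * ((if a = 0 then 1 / ((z 0 - z p.1.1) * (z 0 - z p.1.2)) else 0)
        + (if a = p.1.1 then 1 / ((z p.1.1 - z 0) * (z p.1.1 - z p.1.2)) else 0)
        + (if a = p.1.2 then 1 / ((z p.1.2 - z 0) * (z p.1.2 - z p.1.1)) else 0))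
  have hq : ∀ p (g : Fin (n + 1) → ℂ), ∑ a, q p a * g a = C p *
      (g 0 / ((z 0 - z p.1.1) * (z 0 - z p.1.2))
        + g p.1.1 / ((z p.1.1 - z 0) * (z p.1.1 - z p.1.2))
        + g p.1.2 / ((z p.1.2 - z 0) * (z p.1.2 - z p.1.1))) := by
    intro p g
    simp only [q, mul_assoc, add_mul, ite_mul, zero_mul, mul_add, Finset.sum_add_distrib,
      ← Finset.mul_sum, Finset.sum_ite_eq', Finset.sum_ite_eq, Finset.mem_univ, if_true]
    ring
  let L : (PairIdx n → ℂ) →ₗ[ℂ] (Fin (n + 1) → ℂ) :=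
    { toFun := fun c a => ∑ p, c p * q p a
      map_add' := fun c d => by ext a; simp [add_mul, Finset.sum_add_distrib]
      map_smul' := fun r c => by ext a; simp [mul_assoc, Finset.mul_sum] }
  have hL : ∀ c a, L c a = ∑ p, c p * q p a := fun _ _ => rfl
  have hLg : ∀ c (g : Fin (n + 1) → ℂ), ∑ a, L c a * g a = ∑ p, c p * ∑ a, q p a * g a := by
    intro c g
    simp only [hL, Finset.sum_mul, Finset.mul_sum]
    rw [Finset.sum_comm]
    simp only [mul_assoc]
  have hL0 : ∀ c, ∑ a, L c a * z a ^ 0 = 0 := by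
    intro c
    rw [hLg]
    refine Finset.sum_eq_zero fun p _ => ?_
    rw [hq]
    have := d01 p; have := d02 p; have := d12 p; have := d10 p; have := d20 p; have := d21 p
    have e1 : z p.1.1 - z 0 = -(z 0 - z p.1.1) := by ring
    have e2 : z p.1.2 - z 0 = -(z 0 - z p.1.2) := by ring
    have e3 : z p.1.2 - z p.1.1 = -(z p.1.1 - z p.1.2) := by ring
    rw [e1, e2, e3]
    field_simp
    ring
  have hL1 : ∀ c, ∑ a, L c a * z a ^ 1 = 0 := by
    intro c
    rw [hLg]
    refine Finset.sum_eq_zero fun p _ => ?_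
    rw [hq]
    have := d01 p; have := d02 p; have := d12 p; have := d10 p; have := d20 p; have := d21 p
    have e1 : z p.1.1 - z 0 = -(z 0 - z p.1.1) := by ring
    have e2 : z p.1.2 - z 0 = -(z 0 - z p.1.2) := by ring
    have e3 : z p.1.2 - z p.1.1 = -(z p.1.1 - z p.1.2) := by ring
    rw [e1, e2, e3]
    field_simp
    ring
  have hLk : ∀ c (k : ℕ), ∑ a, L c a * z a ^ (k + 2) =
      ((k : ℂ) + 1) * (k + 2) * ∑ p, c p * I p k := by
    intro c k
    rw [hLg, Finset.mul_sum]
    refine Finset.sum_congr rfl fun p _ => ?_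
    rw [hq]; linear_combination - c p * hI p k
  have hk0 : ∀ k : ℕ, ((k : ℂ) + 1) * (k + 2) ≠ 0 := by
    intro k; norm_cast
  obtain ⟨m, rfl⟩ : ∃ m, n = m + 1 := ⟨n - 1, by omega⟩
  let R : (Fin (m + 1 + 1) → ℂ) →ₗ[ℂ] (Fin m → ℂ) := LinearMap.funLeft ℂ ℂ (fun j => j.succ.succ)
  have hR : ∀ f j, R f j = f j.succ.succ := fun _ _ => rfl
  refine ⟨LinearMap.ker (R ∘ₗ L), ?_, ?_⟩
  · ext c
    simp only [SetLike.mem_coe, LinearMap.mem_ker, Set.mem_ofPred_eq]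
    constructor
    · intro h
      have h2 : ∀ j : Fin m, L c j.succ.succ = 0 := fun j => congrFun h j
      have a0 := hL0 c
      have a1 := hL1 c
      rw [Fin.sum_univ_succ, Fin.sum_univ_succ] at a0 a1
      simp only [h2, zero_mul, Finset.sum_const_zero, pow_zero, pow_one] at a0 a1
      have h01 : z (Fin.succ 0) - z 0 ≠ 0 := fun h => by
        have := hz (sub_eq_zero.1 h)
        exact Fin.succ_ne_zero _ this
      have b1 : L c (Fin.succ 0) = 0 := by
        apply (mul_eq_zero.1 (_ : L c (Fin.succ 0) * (z (Fin.succ 0) - z 0) = 0)).resolve_right h01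
        linear_combination a1 - z 0 * a0
      have b0 : L c 0 = 0 := by linear_combination a0 - b1
      intro k
      have := hLk c k
      rw [Fin.sum_univ_succ, Fin.sum_univ_succ] at this
      simp only [h2, b0, b1, zero_mul, Finset.sum_const_zero, add_zero] at this
      exact (mul_eq_zero.1 this.symm).resolve_left (hk0 k)
    · intro h
      have : L c = 0 := by
        apply vander z hz
        intro e
        match e with
        | 0 => exact hL0 c
        | 1 => exact hL1 c
        | k + 2 => rw [hLk, h k, mul_zero]
      simp [this]
  · have hsurj : Function.Surjective (R ∘ₗ L) := by
      intro y
      let y' : Fin (m + 1 + 1) → ℂ := Fin.cons 0 (Fin.cons 0 y)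
      refine ⟨fun p => if (p.1.1 : ℕ) = 1 then y' p.1.2 / q p p.1.2 else 0, ?_⟩
      ext j
      rw [LinearMap.comp_apply, hR, hL]
      let p0 : PairIdx (m + 1) := ⟨(Fin.succ 0, j.succ.succ), by simp, by simp⟩
      rw [Finset.sum_eq_single p0]
      · have : q p0 j.succ.succ ≠ 0 := by
          have e0 : j.succ.succ ≠ p0.1.1 := by
            intro h; simp [p0, Fin.ext_iff] at h
          have e1 : p0.1.2 = j.succ.succ := rfl
          have := d20 p0
          have := d21 p0
          have h0 := hC p0
          simp only [q, e0, Fin.succ_ne_zero, if_false, zero_add]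
          rw [if_pos e1.symm]
          exact mul_ne_zero h0 (one_div_ne_zero (mul_ne_zero (d20 p0) (d21 p0)))
        have e1 : p0.1.2 = j.succ.succ := rfl
        have e2 : (p0.1.1 : ℕ) = 1 := rfl
        rw [if_pos e2, e1, div_mul_cancel₀ _ this]
        simp [y']
      · intro p _ hp
        split_ifs with h1
        · have e1 : j.succ.succ ≠ p.1.1 := by
            intro h; rw [← h] at h1; simp at h1
          have e2 : j.succ.succ ≠ p.1.2 := by
            intro h
            apply hp
            apply Subtype.ext
            apply Prod.ext
            · apply Fin.ext; rw [h1]; rfl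
            · exact h.symm
          simp [q, e1, e2]
        · simp
      · simp
    have hrn := LinearMap.finrank_range_add_finrank_ker (R ∘ₗ L)
    rw [LinearMap.range_eq_top.2 hsurj, finrank_top, Module.finrank_fintype_fun_eq_card,
      Module.finrank_fintype_fun_eq_card, card_pairIdx, Fintype.card_fin,
      Nat.choose_succ_succ' m 1, Nat.choose_one_right] at hrn
    simp only [Nat.add_sub_cancel, one_add_one_eq_two] at hrn ⊢
    omega


/-- For a nondegenerate tuple `z_0, …, z_n` (`n ≥ 2`), the set of families
`c = (c_{ij})_{1 ≤ i < j ≤ n}` of complex numbers all of whose harmonic moments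
`Σ_{i<j} c_{ij} ∫_{conv{z_0,z_i,z_j}} w^k dvol(w)` vanish is a `ℂ`-linear subspace of
`ℂ^{C(n,2)}` of dimension `C(n-1,2)`. -/
theorem dim_complex_null_measures
    (n : ℕ) (hn : 2 ≤ n) (z : Fin (n + 1) → ℂ) (hz : Nondegenerate z) :
    ∃ V : Submodule ℂ (PairIdx n → ℂ),
      (V : Set (PairIdx n → ℂ)) =
        {c | ∀ k : ℕ,
          ∑ p : PairIdx n,
            c p * ∫ w in convexHull ℝ ({z 0, z p.1.1, z p.1.2} : Set ℂ), w ^ k = 0} ∧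
      Module.finrank ℂ ↥V = (n - 1).choose 2 := by
  have hne : ∀ p : PairIdx n, ¬ Collinear ℝ ({z 0, z p.1.1, z p.1.2} : Set ℂ) := by
    intro p
    have h1 := p.2.1
    have h2 := p.2.2
    apply hz.2
    · intro h; rw [← h] at h1; simp at h1
    · intro h; rw [← h] at h2; simp at h2
    · intro h; rw [← h] at h2; simp at h2
  choose C hC hI using fun p : PairIdx n => tri_int _ _ _ (hne p)
  exact linear_part n hn z hz.1 C hC _ hI
end

section
/- Let n ≥ 2 and let z_0, z_1, …, z_n ∈ ℂ be nondegenerate. Then the set of families c = (c_{ij})_{1≤i<j≤n} of real numbers satisfying, for every natural number k, Σ_{1≤i<j≤n} c_{ij} · ∫_{convexHull ℝ {z_0,z_i,z_j}} w^k dvolume(w) = 0, is an ℝ-linear subspace of ℝ^{C(n,2)} of dimension (n−2)(n−3)/2 (= C(n−2,2); in particular this dimension is 0 for n = 2 and n = 3). -/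
open MeasureTheory

def crs (p q : ℂ) : ℝ := p.re * q.im - p.im * q.re

lemma crs_ne {a b c : ℂ} (hab : a ≠ b) (h : ¬ Collinear ℝ ({a, b, c} : Set ℂ)) :
    crs (b - a) (c - a) ≠ 0 := by
  intro h0
  apply h
  rw [collinear_iff_of_mem (p₀ := a) (by simp)]
  have hN : (b - a).re * (b-a).re + (b-a).im * (b-a).im ≠ 0 := by
    intro hh
    apply hab
    have := Complex.normSq_eq_zero.1 (show Complex.normSq (b - a) = 0 by rw [Complex.normSq_apply]; exact hh)
    exact (sub_eq_zero.1 this).symm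
  refine ⟨b - a, ?_⟩
  intro p hp
  simp only [Set.mem_insert_iff, Set.mem_singleton_iff] at hp
  rcases hp with rfl | rfl | rfl
  · exact ⟨0, by simp⟩
  · exact ⟨1, by simp⟩
  · refine ⟨((p-a).re * (b-a).re + (p-a).im * (b-a).im) / ((b - a).re * (b-a).re + (b-a).im * (b-a).im), ?_⟩
    unfold crs at h0
    rw [vadd_eq_add, ← sub_eq_iff_eq_add]
    apply Complex.ext
    · rw [Complex.smul_re, smul_eq_mul, div_mul_eq_mul_div, eq_div_iff hN]
      linear_combination (-(b-a).im) * h0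
    · rw [Complex.smul_im, smul_eq_mul, div_mul_eq_mul_div, eq_div_iff hN]
      linear_combination ((b-a).re) * h0

lemma crs_solve {p q : ℂ} (h : crs p q ≠ 0) (w : ℂ) : ∃ x y : ℝ, (x:ℂ) * p + y * q = w := by
  refine ⟨crs w q / crs p q, crs p w / crs p q, ?_⟩
  apply Complex.ext
  · simp only [Complex.add_re, Complex.re_ofReal_mul]
    field_simp
    unfold crs; ring
  · simp only [Complex.add_im, Complex.im_ofReal_mul]
    field_simp
    unfold crs; ring

lemma crs_inj {p q : ℂ} (h : crs p q ≠ 0) {x y : ℝ} (hh : (x:ℂ) * p + y * q = 0) :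
    x = 0 ∧ y = 0 := by
  have h1 := congrArg Complex.re hh
  have h2 := congrArg Complex.im hh
  simp only [Complex.add_re, Complex.re_ofReal_mul, Complex.zero_re, Complex.add_im, Complex.im_ofReal_mul, Complex.zero_im] at h1 h2
  constructor
  · have : x * crs p q = 0 := by unfold crs; linear_combination q.im * h1 - q.re * h2
    simpa [h] using this
  · have : y * crs p q = 0 := by unfold crs; linear_combination p.re * h2 - p.im * h1
    simpa [h] using this

/-- one-dimensional integral of a power of an affine function -/
lemma int_aff (u v : ℂ) (hv : v ≠ 0) (k : ℕ) (T : ℝ) :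
    ∫ t in (0:ℝ)..T, (u + t * v) ^ k = ((u + T * v) ^ (k+1) - u ^ (k+1)) / ((k+1) * v) := by
  have hk : ((k:ℂ)+1) ≠ 0 := by exact_mod_cast Nat.succ_ne_zero k
  have hd : ∀ t : ℝ, HasDerivAt (fun t : ℝ => (u + t * v) ^ (k+1) / ((k+1) * v)) ((u + t * v) ^ k) t := by
    intro t
    have h1 : HasDerivAt (fun t : ℝ => u + (t:ℂ) * v) v t := by
      simpa using ((Complex.ofRealCLM.hasDerivAt (x := t)).mul_const v).const_add u
    have := (h1.pow (k+1)).div_const ((k+1) * v)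
    have e : (u + t * v) ^ k = ((k + 1 : ℕ) : ℂ) * (u + t * v) ^ (k + 1 - 1) * v / ((k+1) * v) := by
      rw [eq_div_iff (mul_ne_zero hk hv)]
      simp
      ring
    rw [e]
    exact this
  rw [intervalIntegral.integral_eq_sub_of_hasDerivAt (fun t _ => hd t)]
  · simp; ring
  · apply Continuous.intervalIntegrable; fun_prop

def stdS : Set (ℝ × ℝ) := {p | 0 ≤ p.1 ∧ 0 ≤ p.2 ∧ p.1 + p.2 ≤ 1}

lemma isCompact_stdS : IsCompact stdS := by
  apply IsCompact.of_isClosed_subset (isCompact_Icc : IsCompact (Set.Icc ((0:ℝ),(0:ℝ)) (1,1)))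
  · unfold stdS
    exact (isClosed_le continuous_const continuous_fst).inter
      ((isClosed_le continuous_const continuous_snd).inter
        (isClosed_le (continuous_fst.add continuous_snd) continuous_const))
  · rintro ⟨s, t⟩ ⟨h1, h2, h3⟩
    simp only at h1 h2 h3
    exact ⟨⟨h1, h2⟩, ⟨by simp; linarith, by simp; linarith⟩⟩

lemma int_std (a b c : ℂ) (hab : a ≠ b) (hac : a ≠ c) (hbc : b ≠ c) (k : ℕ) :
    ((k:ℂ)+1) * (k+2) * ∫ p in stdS, (a + p.1 * (b - a) + p.2 * (c - a)) ^ k =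
      ((b^(k+2) - a^(k+2))/(b-a) - (c^(k+2) - a^(k+2))/(c-a)) / (b - c) := by
  have hk : ((k:ℂ)+1) ≠ 0 := by exact_mod_cast Nat.succ_ne_zero k
  have hk2 : ((k:ℂ)+2) ≠ 0 := by exact_mod_cast Nat.succ_ne_zero (k+1)
  have h1 : b - a ≠ 0 := sub_ne_zero.2 hab.symm
  have h2 : c - a ≠ 0 := sub_ne_zero.2 hac.symm
  have h3 : b - c ≠ 0 := sub_ne_zero.2 hbc
  have hm : MeasurableSet stdS := isCompact_stdS.isClosed.measurableSet
  have hFint : IntegrableOn (fun p : ℝ × ℝ => (a + p.1 * (b - a) + p.2 * (c - a)) ^ k) stdS :=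
    ContinuousOn.integrableOn_compact isCompact_stdS (by fun_prop)
  rw [← integral_indicator hm, Measure.volume_eq_prod, integral_prod]
  swap
  · rw [← Measure.volume_eq_prod]; exact hFint.integrable_indicator hm
  have hin : ∀ s : ℝ, ∫ t : ℝ, stdS.indicator (fun p : ℝ × ℝ => (a + p.1 * (b - a) + p.2 * (c - a)) ^ k) (s, t) =
      (Set.Icc (0:ℝ) 1).indicator (fun s : ℝ => ((c + s * (b - c)) ^ (k+1) - (a + s * (b-a)) ^ (k+1)) / ((k+1) * (c - a))) s := by
    intro s
    by_cases hs : s ∈ Set.Icc (0:ℝ) 1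
    · rw [Set.indicator_of_mem hs]
      have : ∀ t : ℝ, stdS.indicator (fun p : ℝ × ℝ => (a + p.1 * (b - a) + p.2 * (c - a)) ^ k) (s, t)
        = (Set.Icc 0 (1-s)).indicator (fun t : ℝ => ((a + s * (b - a)) + t * (c - a)) ^ k) t := by
        intro t
        have hh : (s,t) ∈ stdS ↔ t ∈ Set.Icc 0 (1-s) := by
          simp only [stdS, Set.mem_ofPred_eq, Set.mem_Icc]
          constructor
          · rintro ⟨_, h, h'⟩; exact ⟨h, by linarith⟩
          · rintro ⟨h, h'⟩; exact ⟨hs.1, h, by linarith⟩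
        by_cases ht : t ∈ Set.Icc 0 (1-s)
        · rw [Set.indicator_of_mem ht, Set.indicator_of_mem (hh.2 ht)]
        · rw [Set.indicator_of_notMem ht, Set.indicator_of_notMem (fun h => ht (hh.1 h))]
      simp_rw [this]
      rw [integral_indicator measurableSet_Icc, integral_Icc_eq_integral_Ioc,
        ← intervalIntegral.integral_of_le (by linarith [hs.2]), int_aff _ _ h2]
      push_cast
      ring_nf
    · rw [Set.indicator_of_notMem hs]
      have : ∀ t : ℝ, stdS.indicator (fun p : ℝ × ℝ => (a + p.1 * (b - a) + p.2 * (c - a)) ^ k) (s, t) = 0 := by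
        intro t
        apply Set.indicator_of_notMem
        rintro ⟨h, h', h''⟩
        simp only at h h' h''
        exact hs ⟨h, by linarith⟩
      simp [this]
  simp_rw [hin]
  rw [integral_indicator measurableSet_Icc, integral_Icc_eq_integral_Ioc,
        ← intervalIntegral.integral_of_le zero_le_one, intervalIntegral.integral_div,
        intervalIntegral.integral_sub, int_aff _ _ h3, int_aff _ _ h1]
  · push_cast
    simp only [one_mul, add_sub_cancel]
    have hk2' : (k:ℂ) + 1 + 1 ≠ 0 := by rw [add_assoc]; norm_num; exact hk2
    have e : (k:ℂ) + 2 = k + 1 + 1 := by ring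
    rw [e]
    field_simp
    ring
  · apply Continuous.intervalIntegrable; fun_prop
  · apply Continuous.intervalIntegrable; fun_prop

lemma tri_hull (a b c : ℂ) : convexHull ℝ ({a, b, c} : Set ℂ) =
    (fun w : ℂ => a + w.re * (b - a) + w.im * (c - a)) '' (Complex.measurableEquivRealProd ⁻¹' stdS) := by
  rw [convexHull_insert (by simp), convexHull_pair]
  ext w
  simp only [mem_convexJoin, Set.mem_singleton_iff, exists_eq_left, Set.mem_image, Set.mem_preimage,
    Complex.measurableEquivRealProd_apply, stdS, Set.mem_ofPred_eq]
  constructor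
  · rintro ⟨y, ⟨r, s, hr, hs, hrs, rfl⟩, ⟨r', s', hr', hs', hrs', rfl⟩⟩
    refine ⟨⟨s' * r, s' * s⟩, ⟨by positivity, by positivity, ?_⟩, ?_⟩
    · rw [← mul_add, hrs]; linarith
    · have e1 : (r':ℂ) = 1 - s' := by rw [eq_sub_iff_add_eq]; exact_mod_cast hrs'
      have e2 : (r:ℂ) = 1 - s := by rw [eq_sub_iff_add_eq]; exact_mod_cast hrs
      simp only [Complex.real_smul]
      push_cast
      rw [e1, e2]; ring
  · rintro ⟨v, ⟨h1, h2, h3⟩, rfl⟩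
    by_cases h0 : v.re + v.im = 0
    · have e1 : v.re = 0 := by linarith
      have e2 : v.im = 0 := by linarith
      refine ⟨b, left_mem_segment _ _ _, ?_⟩
      simp [e1, e2, left_mem_segment]
    · refine ⟨_, ⟨v.re / (v.re + v.im), v.im / (v.re + v.im), by positivity, by positivity, by field_simp, rfl⟩,
        ⟨1 - (v.re + v.im), v.re + v.im, by linarith, by linarith, by ring, ?_⟩⟩
      have h0' : (v.re:ℂ) + v.im ≠ 0 := by exact_mod_cast h0
      simp only [Complex.real_smul]
      push_cast
      field_simp
      ring

lemma tri_moment (a b c : ℂ) (hab : a ≠ b) (hac : a ≠ c) (hbc : b ≠ c)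
    (h : ¬ Collinear ℝ ({a, b, c} : Set ℂ)) : ∃ κ : ℝ, κ ≠ 0 ∧ ∀ k : ℕ,
    ((k:ℂ)+1) * (k+2) * ∫ w in convexHull ℝ ({a, b, c} : Set ℂ), w ^ k =
      κ * (((b^(k+2) - a^(k+2))/(b-a) - (c^(k+2) - a^(k+2))/(c-a)) / (b - c)) := by
  let L : ℂ →L[ℝ] ℂ := Complex.reCLM.smulRight (b - a) + Complex.imCLM.smulRight (c - a)
  have hL : ∀ w, L w = w.re * (b - a) + w.im * (c - a) := by
    intro w; simp [L]
  have hinj : Function.Injective L := by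
    rw [injective_iff_map_eq_zero]
    intro w hw
    rw [hL] at hw
    obtain ⟨h1, h2⟩ := crs_inj (crs_ne hab h) hw
    exact Complex.ext h1 h2
  have hdet : L.det ≠ 0 := by
    have := LinearEquiv.isUnit_det' (LinearEquiv.ofInjectiveEndo (L : ℂ →ₗ[ℝ] ℂ) hinj)
    exact this.ne_zero
  refine ⟨|L.det|, abs_ne_zero.2 hdet, fun k => ?_⟩
  have hS : MeasurableSet (Complex.measurableEquivRealProd ⁻¹' stdS) :=
    Complex.measurableEquivRealProd.measurable isCompact_stdS.isClosed.measurableSet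
  have hfun : (fun w : ℂ => a + w.re * (b - a) + w.im * (c - a)) = fun w => a + L w := by
    funext w; rw [hL]; ring
  rw [tri_hull, hfun, integral_image_eq_integral_abs_det_fderiv_smul volume hS (f' := fun _ => L)
    (fun x _ => (L.hasFDerivAt.const_add a).hasFDerivWithinAt)
    (fun x _ y _ hxy => hinj (add_left_cancel hxy)), integral_smul,
    ← int_std a b c hab hac hbc k,
    ← Complex.volume_preserving_equiv_real_prod.setIntegral_preimage_emb
      Complex.measurableEquivRealProd.measurableEmbedding]
  simp only [Complex.measurableEquivRealProd_apply, hL, Complex.real_smul, add_assoc]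
  ring

/-- The equilibrium map. -/
noncomputable def eqMap {n : ℕ} (z : Fin (n+1) → ℂ) : (PairIdx n → ℝ) →ₗ[ℝ] (Fin (n+1) → ℂ) where
  toFun d := fun k => ∑ p : PairIdx n, (d p : ℂ) *
    (((if k = p.1.1 then 1 else 0) - (if k = p.1.2 then 1 else 0)) / (z p.1.1 - z p.1.2))
  map_add' d e := by
    funext k
    simp only [Pi.add_apply, ← Finset.sum_add_distrib]
    exact Finset.sum_congr rfl fun p _ => by push_cast; ring
  map_smul' r d := by
    funext k
    simp only [Pi.smul_apply, RingHom.id_apply, Complex.real_smul, Finset.mul_sum, smul_eq_mul]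
    exact Finset.sum_congr rfl fun p _ => by push_cast; ring

lemma eqMap_apply {n : ℕ} (z : Fin (n+1) → ℂ) (d : PairIdx n → ℝ) (k) : eqMap z d k =
  ∑ p : PairIdx n, (d p : ℂ) *
    (((if k = p.1.1 then 1 else 0) - (if k = p.1.2 then 1 else 0)) / (z p.1.1 - z p.1.2)) := rfl

lemma sum_eqMap {n : ℕ} (z : Fin (n+1) → ℂ) (d : PairIdx n → ℝ) (h : Fin (n+1) → ℂ) :
    ∑ k, h k * eqMap z d k =
      ∑ p : PairIdx n, (d p : ℂ) * ((h p.1.1 - h p.1.2) / (z p.1.1 - z p.1.2)) := by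
  simp only [eqMap_apply, Finset.mul_sum]
  rw [Finset.sum_comm]
  refine Finset.sum_congr rfl fun p _ => ?_
  have : ∀ k, h k * ((d p : ℂ) *
    (((if k = p.1.1 then 1 else 0) - (if k = p.1.2 then 1 else 0)) / (z p.1.1 - z p.1.2)))
     = (d p : ℂ) / (z p.1.1 - z p.1.2) * ((if k = p.1.1 then h k else 0) - (if k = p.1.2 then h k else 0)) := by
    intro k; split_ifs <;> ring
  simp only [this]
  rw [← Finset.mul_sum, Finset.sum_sub_distrib]
  simp
  ring

lemma pair_ne {n : ℕ} (p : PairIdx n) : p.1.1 ≠ 0 ∧ p.1.2 ≠ 0 ∧ p.1.1 ≠ p.1.2 := by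
  obtain ⟨⟨i, j⟩, h1, h2⟩ := p
  simp only at h1 h2 ⊢
  refine ⟨?_, ?_, ?_⟩ <;> (rintro rfl; simp at *)

lemma eqMap_zero {n : ℕ} (z : Fin (n+1) → ℂ) (d : PairIdx n → ℝ) : eqMap z d 0 = 0 := by
  rw [eqMap_apply]
  refine Finset.sum_eq_zero fun p _ => ?_
  rw [if_neg (pair_ne p).1.symm, if_neg (pair_ne p).2.1.symm]; simp

lemma pair_z_ne {n : ℕ} {z : Fin (n+1) → ℂ} (hz : Function.Injective z) (p : PairIdx n) :
    z p.1.1 - z p.1.2 ≠ 0 := sub_ne_zero.2 fun h => (pair_ne p).2.2 (hz h)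

lemma sum_one {n : ℕ} (z : Fin (n+1) → ℂ) (d : PairIdx n → ℝ) : ∑ k, eqMap z d k = 0 := by
  have := sum_eqMap z d (fun _ => 1)
  simpa using this

lemma sum_z {n : ℕ} {z : Fin (n+1) → ℂ} (hz : Function.Injective z) (d : PairIdx n → ℝ) :
    ∑ k, z k * eqMap z d k = ((∑ p, d p : ℝ) : ℂ) := by
  rw [sum_eqMap]
  push_cast
  exact Finset.sum_congr rfl fun p _ => by rw [div_self (pair_z_ne hz p), mul_one]

lemma eqMap_ker_iff {n : ℕ} {z : Fin (n+1) → ℂ} (hz : Function.Injective z) (d : PairIdx n → ℝ) :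
    eqMap z d = 0 ↔ ∀ k : ℕ, ∑ p : PairIdx n, (d p : ℂ) *
      (((z p.1.1 ^ (k+2) - z 0 ^ (k+2)) / (z p.1.1 - z 0)
        - (z p.1.2 ^ (k+2) - z 0 ^ (k+2)) / (z p.1.2 - z 0)) / (z p.1.1 - z p.1.2)) = 0 := by
  have key := fun k : ℕ => sum_eqMap z d (fun i => (z i ^ (k+2) - z 0 ^ (k+2)) / (z i - z 0))
  simp only [← key]
  constructor
  · intro h k; simp [h]
  · intro h
    have hpow : ∀ m : ℕ, ∑ i, (z i ^ m - z 0 ^ m) / (z i - z 0) * eqMap z d i = 0 := by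
      intro m
      match m with
      | 0 => simp
      | 1 =>
        rw [← sum_one z d]
        refine Finset.sum_congr rfl fun i _ => ?_
        by_cases hi : i = 0
        · subst hi; simp [eqMap_zero]
        · rw [pow_one, pow_one, div_self (sub_ne_zero.2 fun h => hi (hz h)), one_mul]
      | k+2 => exact h k
    have hpoly : ∀ f : Polynomial ℂ, ∑ i, (f.eval (z i) - f.eval (z 0)) / (z i - z 0) * eqMap z d i = 0 := by
      intro f
      induction f using Polynomial.induction_on' with
      | add p q hp hq =>
        have := congrArg₂ (· + ·) hp hq
        simp only [← Finset.sum_add_distrib, add_zero] at this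
        rw [← this]
        refine Finset.sum_congr rfl fun i _ => ?_
        simp only [Polynomial.eval_add]; ring
      | monomial m a =>
        have := congrArg (a * ·) (hpow m)
        simp only [Finset.mul_sum, mul_zero] at this
        rw [← this]
        refine Finset.sum_congr rfl fun i _ => ?_
        simp only [Polynomial.eval_monomial]; ring
    funext i
    by_cases hi : i = 0
    · subst hi; simp [eqMap_zero]
    have := hpoly (∏ j ∈ Finset.univ.erase i, (Polynomial.X - Polynomial.C (z j)))
    have hev : ∀ k, k ≠ i → (∏ j ∈ Finset.univ.erase i, (Polynomial.X - Polynomial.C (z j))).eval (z k) = 0 := by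
      intro k hk
      rw [Polynomial.eval_prod]
      exact Finset.prod_eq_zero (Finset.mem_erase.2 ⟨hk, Finset.mem_univ k⟩) (by simp)
    rw [Finset.sum_eq_single i] at this
    · rw [hev 0 (Ne.symm hi), sub_zero, mul_eq_zero, div_eq_zero_iff] at this
      rcases this with (h | h) | h
      · exfalso
        rw [Polynomial.eval_prod, Finset.prod_eq_zero_iff] at h
        obtain ⟨j, hj, hj'⟩ := h
        simp only [Polynomial.eval_sub, Polynomial.eval_X, Polynomial.eval_C] at hj'
        exact (Finset.mem_erase.1 hj).1 (hz (sub_eq_zero.1 hj')).symm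
      · exact absurd (hz (sub_eq_zero.1 h)) hi
      · simpa using h
    · intro k _ hk
      rw [hev k hk, hev 0 (Ne.symm hi)]; simp
    · simp

section rank
variable {n : ℕ}

def ione (hn : 2 ≤ n) : Fin (n+1) := ⟨1, by omega⟩
def itwo (hn : 2 ≤ n) : Fin (n+1) := ⟨2, by omega⟩
def pone (hn : 2 ≤ n) (k : Fin (n+1)) (hk : 3 ≤ (k:ℕ)) : PairIdx n :=
  ⟨(ione hn, k), by simp [ione], by simp [ione]; omega⟩
def ptwo (hn : 2 ≤ n) (k : Fin (n+1)) (hk : 3 ≤ (k:ℕ)) : PairIdx n :=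
  ⟨(itwo hn, k), by simp [itwo], by simp [itwo]; omega⟩
def ptop (hn : 2 ≤ n) : PairIdx n :=
  ⟨(ione hn, itwo hn), by simp [ione], by simp [ione, itwo]⟩

lemma pone_val (hn : 2 ≤ n) (k : Fin (n+1)) (hk : 3 ≤ (k:ℕ)) : (pone hn k hk).1 = (ione hn, k) := rfl
lemma ptwo_val (hn : 2 ≤ n) (k : Fin (n+1)) (hk : 3 ≤ (k:ℕ)) : (ptwo hn k hk).1 = (itwo hn, k) := rfl
lemma ptop_val (hn : 2 ≤ n) : (ptop hn).1 = (ione hn, itwo hn) := rfl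

lemma pair_cases (hn : 2 ≤ n) (p : PairIdx n) (hp : ¬ 3 ≤ (p.1.1 : ℕ)) :
    p = ptop hn ∨ (∃ k hk, p = pone hn k hk) ∨ (∃ k hk, p = ptwo hn k hk) := by
  obtain ⟨⟨i, j⟩, h1, h2⟩ := p
  simp only at h1 h2 hp
  by_cases hi : (i:ℕ) = 1
  · have e : i = ione hn := Fin.ext hi
    by_cases hj : (j:ℕ) = 2
    · left
      have e' : j = itwo hn := Fin.ext hj
      subst e e'; rfl
    · right; left
      subst e
      exact ⟨j, by omega, rfl⟩
  · have e : i = itwo hn := Fin.ext (by simp [itwo]; omega)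
    right; right
    subst e
    exact ⟨j, by simp [itwo] at h2; omega, rfl⟩

lemma eqMap_off (hn : 2 ≤ n) (z : Fin (n+1) → ℂ) (e : PairIdx n → ℝ)
    (he : ∀ p : PairIdx n, 3 ≤ (p.1.1:ℕ) → e p = 0) (k : Fin (n+1)) (hk : 3 ≤ (k:ℕ)) :
    eqMap z e k = e (pone hn k hk) / (z k - z (ione hn)) + e (ptwo hn k hk) / (z k - z (itwo hn)) := by
  have h1 : k ≠ ione hn := by rintro rfl; simp [ione] at hk
  have h2 : k ≠ itwo hn := by rintro rfl; simp [itwo] at hk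
  rw [eqMap_apply, Fintype.sum_eq_add (pone hn k hk) (ptwo hn k hk)]
  · change (e (pone hn k hk) : ℂ) * (((if k = ione hn then 1 else 0) - (if k = k then 1 else 0)) /
        (z (ione hn) - z k)) + (e (ptwo hn k hk) : ℂ) *
        (((if k = itwo hn then 1 else 0) - (if k = k then 1 else 0)) / (z (itwo hn) - z k)) = _
    generalize e (pone hn k hk) = x
    generalize e (ptwo hn k hk) = y
    rw [if_neg h1, if_neg h2, if_pos rfl, ← neg_sub (z k), ← neg_sub (z k) (z (itwo hn))]
    simp only [zero_sub, neg_div_neg_eq]; ring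
  · intro h
    have := congrArg (fun p : PairIdx n => (p.1.1:ℕ)) h
    simp [pone, ptwo, ione, itwo] at this
  · rintro p ⟨hp1, hp2⟩
    by_cases hp : 3 ≤ (p.1.1:ℕ)
    · simp [he p hp]
    · rcases pair_cases hn p hp with rfl | ⟨j, hj, rfl⟩ | ⟨j, hj, rfl⟩
      · simp [ptop, h1, h2]
      · have : k ≠ j := by rintro rfl; exact hp1 rfl
        simp [pone, h1, this]
      · have : k ≠ j := by rintro rfl; exact hp2 rfl
        simp [ptwo, h2, this]

lemma sum_two (hn : 2 ≤ n) (F : Fin (n+1) → ℂ) (h0 : F 0 = 0) (h : ∀ k : Fin (n+1), 3 ≤ (k:ℕ) → F k = 0) :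
    ∑ k, F k = F (ione hn) + F (itwo hn) := by
  apply Fintype.sum_eq_add
  · simp [ione, itwo]
  · rintro k ⟨h1, h2⟩
    by_cases hk : 3 ≤ (k:ℕ)
    · exact h k hk
    · have : k = 0 := by
        apply Fin.ext
        have a : (k:ℕ) ≠ 1 := fun a => h1 (Fin.ext a)
        have b : (k:ℕ) ≠ 2 := fun a => h2 (Fin.ext a)
        change (k:ℕ) = 0; omega
      rw [this, h0]

lemma noncol_crs {z : Fin (n+1) → ℂ} (hz : Nondegenerate z) (hn : 2 ≤ n) (k : Fin (n+1)) (hk : 3 ≤ (k:ℕ)) :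
    crs (z (itwo hn) - z k) (z (ione hn) - z k) ≠ 0 := by
  have h1 : k ≠ ione hn := by rintro rfl; simp [ione] at hk
  have h2 : k ≠ itwo hn := by rintro rfl; simp [itwo] at hk
  exact crs_ne (fun h => h2 (hz.1 h)) (hz.2 _ _ _ h2 h1 (by simp [ione, itwo]))

lemma k_ne {z : Fin (n+1) → ℂ} (hz : Nondegenerate z) (hn : 2 ≤ n) (k : Fin (n+1)) (hk : 3 ≤ (k:ℕ)) :
    z k - z (ione hn) ≠ 0 ∧ z k - z (itwo hn) ≠ 0 := by
  have h1 : k ≠ ione hn := by rintro rfl; simp [ione] at hk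
  have h2 : k ≠ itwo hn := by rintro rfl; simp [itwo] at hk
  exact ⟨sub_ne_zero.2 fun h => h1 (hz.1 h), sub_ne_zero.2 fun h => h2 (hz.1 h)⟩

lemma ker_inj {z : Fin (n+1) → ℂ} (hz : Nondegenerate z) (hn : 2 ≤ n) (e : PairIdx n → ℝ)
    (he : ∀ p : PairIdx n, 3 ≤ (p.1.1:ℕ) → e p = 0) (hM : eqMap z e = 0) : e = 0 := by
  have h3 : ∀ k hk, e (pone hn k hk) = 0 ∧ e (ptwo hn k hk) = 0 := by
    intro k hk
    have h := eqMap_off hn z e he k hk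
    obtain ⟨n1, n2⟩ := k_ne hz hn k hk
    rw [hM, Pi.zero_apply] at h
    field_simp at h
    exact crs_inj (noncol_crs hz hn k hk) (by linear_combination h)
  have hs := sum_z hz.1 e
  rw [hM, Fintype.sum_eq_single (ptop hn)] at hs
  · have ht : e (ptop hn) = 0 := by simpa using hs.symm
    funext p
    by_cases hp : 3 ≤ (p.1.1:ℕ)
    · exact he p hp
    · rcases pair_cases hn p hp with rfl | ⟨j, hj, rfl⟩ | ⟨j, hj, rfl⟩
      · exact ht
      · exact (h3 j hj).1
      · exact (h3 j hj).2
  · intro p hpt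
    by_cases hp : 3 ≤ (p.1.1:ℕ)
    · exact he p hp
    · rcases pair_cases hn p hp with rfl | ⟨j, hj, rfl⟩ | ⟨j, hj, rfl⟩
      · exact absurd rfl hpt
      · exact (h3 j hj).1
      · exact (h3 j hj).2

lemma ker_surj {z : Fin (n+1) → ℂ} (hz : Nondegenerate z) (hn : 2 ≤ n) (d₀ : PairIdx n → ℝ) :
    ∃ d : PairIdx n → ℝ, (∀ p : PairIdx n, 3 ≤ (p.1.1:ℕ) → d p = d₀ p) ∧ eqMap z d = 0 := by
  classical
  have hex : ∀ k : Fin (n+1), ∃ x y : ℝ, 3 ≤ (k:ℕ) →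
      (x:ℂ) / (z k - z (ione hn)) + y / (z k - z (itwo hn)) = - eqMap z d₀ k := by
    intro k
    by_cases hk : 3 ≤ (k:ℕ)
    · obtain ⟨n1, n2⟩ := k_ne hz hn k hk
      obtain ⟨x, y, h⟩ := crs_solve (noncol_crs hz hn k hk)
        (eqMap z d₀ k * (z k - z (ione hn)) * (z k - z (itwo hn)))
      refine ⟨x, y, fun _ => ?_⟩
      field_simp
      linear_combination -h
    · exact ⟨0, 0, fun h => absurd h hk⟩
  choose x y hxy using hex
  let e : PairIdx n → ℝ := fun p => if (p.1.1:ℕ) = 1 then x p.1.2 else if (p.1.1:ℕ) = 2 then y p.1.2 else 0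
  have he : ∀ p : PairIdx n, 3 ≤ (p.1.1:ℕ) → e p = 0 := by
    intro p hp
    simp only [e]
    rw [if_neg (by omega), if_neg (by omega)]
  have h3 : ∀ k : Fin (n+1), 3 ≤ (k:ℕ) → eqMap z (d₀ + e) k = 0 := by
    intro k hk
    rw [map_add, Pi.add_apply, eqMap_off hn z e he k hk]
    have := hxy k hk
    simp only [e, pone, ptwo, ione, itwo] at this ⊢
    simp only [if_true, if_false, OfNat.ofNat_ne_one]
    rw [this]; ring
  have s1 := sum_one z (d₀ + e)
  rw [sum_two hn _ (eqMap_zero _ _) h3] at s1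
  have s2 := sum_z hz.1 (d₀ + e)
  rw [sum_two hn _ (by simp [eqMap_zero]) (fun k hk => by rw [h3 k hk, mul_zero])] at s2
  set r : ℝ := ∑ p, (d₀ + e) p
  have n12 : z (ione hn) - z (itwo hn) ≠ 0 := pair_z_ne hz.1 (ptop hn)
  have hsing : ∀ k, eqMap z (Pi.single (ptop hn) (-r)) k =
      -r * (((if k = ione hn then 1 else 0) - (if k = itwo hn then 1 else 0)) / (z (ione hn) - z (itwo hn))) := by
    intro k
    rw [eqMap_apply, Fintype.sum_eq_single (ptop hn)]
    · rw [Pi.single_eq_same, ptop_val]; push_cast; rfl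
    · intro p hp; simp [Pi.single_eq_of_ne hp]
  refine ⟨d₀ + e + Pi.single (ptop hn) (-r), ?_, ?_⟩
  · intro p hp
    have : p ≠ ptop hn := by rintro rfl; simp [ptop, ione] at hp
    simp [Pi.single_eq_of_ne this, he p hp]
  · have ne12 : ione hn ≠ itwo hn := by simp [ione, itwo]
    funext k
    rw [map_add, Pi.add_apply, hsing]
    by_cases hk : 3 ≤ (k:ℕ)
    · have h1 : k ≠ ione hn := by rintro rfl; simp [ione] at hk
      have h2 : k ≠ itwo hn := by rintro rfl; simp [itwo] at hk
      simp [h3 k hk, h1, h2]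
    by_cases h1 : k = ione hn
    · subst h1
      simp only [if_true, if_neg ne12, Pi.zero_apply]
      field_simp
      linear_combination s2 - z (itwo hn) * s1
    by_cases h2 : k = itwo hn
    · subst h2
      simp only [if_true, if_neg ne12.symm, Pi.zero_apply]
      field_simp
      linear_combination -s2 + z (ione hn) * s1
    have : k = 0 := by
        apply Fin.ext
        have a : (k:ℕ) ≠ 1 := fun a => h1 (Fin.ext a)
        have b : (k:ℕ) ≠ 2 := fun a => h2 (Fin.ext a)
        change (k:ℕ) = 0; omega
    rw [if_neg h1, if_neg h2, this, eqMap_zero]; simp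

def pairEquiv (hn : 2 ≤ n) : {p : PairIdx n // 3 ≤ (p.1.1:ℕ)} ≃ Σ j : Fin (n-2), Fin (j:ℕ) where
  toFun q := ⟨⟨(q.1.1.2:ℕ) - 3, by have := q.2; have := q.1.2.2; have := q.1.1.2.2; omega⟩,
    ⟨(q.1.1.1:ℕ) - 3, by have := q.2; have := q.1.2.2; simp only; omega⟩⟩
  invFun s := ⟨⟨(⟨(s.2:ℕ) + 3, by have := s.1.2; have := s.2.2; omega⟩,
      ⟨(s.1:ℕ) + 3, by have := s.1.2; omega⟩), by simp, by have := s.2.2; simp⟩, by simp⟩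
  left_inv := by
    rintro ⟨⟨⟨i, j⟩, h1, h2⟩, h3⟩
    simp only at h1 h2 h3
    apply Subtype.ext; apply Subtype.ext
    apply Prod.ext <;> apply Fin.ext <;> simp only <;> omega
  right_inv := by
    rintro ⟨⟨j, hj⟩, ⟨i, hi⟩⟩
    rfl

lemma finrank_ker {z : Fin (n+1) → ℂ} (hz : Nondegenerate z) (hn : 2 ≤ n) :
    Module.finrank ℝ (LinearMap.ker (eqMap z)) = (n-2).choose 2 := by
  let R : LinearMap.ker (eqMap z) →ₗ[ℝ] ({p : PairIdx n // 3 ≤ (p.1.1:ℕ)} → ℝ) :=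
    (LinearMap.funLeft ℝ ℝ Subtype.val).comp (LinearMap.ker (eqMap z)).subtype
  have hR : ∀ d p, R d p = d.1 p.1 := fun d p => rfl
  have hb : Function.Bijective R := by
    constructor
    · rw [injective_iff_map_eq_zero]
      intro d hd
      apply Subtype.ext
      exact ker_inj hz hn d.1 (fun p hp => by rw [← hR d ⟨p, hp⟩, hd]; rfl) d.2
    · intro e
      obtain ⟨d, h1, h2⟩ := ker_surj hz hn (fun p => if hp : 3 ≤ (p.1.1:ℕ) then e ⟨p, hp⟩ else 0)
      refine ⟨⟨d, h2⟩, ?_⟩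
      funext p
      rw [hR]
      simp only
      rw [h1 p.1 p.2, dif_pos p.2]
  rw [(LinearEquiv.ofBijective R hb).finrank_eq, Module.finrank_fintype_fun_eq_card,
    Fintype.card_congr (pairEquiv hn), Fintype.card_sigma]
  simp only [Fintype.card_fin]
  rw [Fin.sum_univ_eq_sum_range (fun i => i), Finset.sum_range_id, Nat.choose_two_right]

end rank

/-- For a nondegenerate tuple `z_0, …, z_n` (`n ≥ 2`), the set of families
`c = (c_{ij})_{1 ≤ i < j ≤ n}` of real numbers all of whose harmonic moments
`Σ_{i<j} c_{ij} ∫_{conv{z_0,z_i,z_j}} w^k dvol(w)` vanish is an `ℝ`-linear subspace of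
`ℝ^{C(n,2)}` of dimension `C(n-2,2)`. -/
theorem dim_real_null_measures
    (n : ℕ) (hn : 2 ≤ n) (z : Fin (n + 1) → ℂ) (hz : Nondegenerate z) :
    ∃ V : Submodule ℝ (PairIdx n → ℝ),
      (V : Set (PairIdx n → ℝ)) =
        {c | ∀ k : ℕ,
          ∑ p : PairIdx n,
            (c p : ℂ) * ∫ w in convexHull ℝ ({z 0, z p.1.1, z p.1.2} : Set ℂ), w ^ k = 0} ∧
      Module.finrank ℝ ↥V = (n - 2).choose 2 := by
  have hκ := fun p : PairIdx n => tri_moment (z 0) (z p.1.1) (z p.1.2)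
    (fun h => (pair_ne p).1 (hz.1 h).symm) (fun h => (pair_ne p).2.1 (hz.1 h).symm)
    (fun h => (pair_ne p).2.2 (hz.1 h))
    (hz.2 _ _ _ (pair_ne p).1.symm (pair_ne p).2.1.symm (pair_ne p).2.2)
  choose κ hκ0 hκ using hκ
  let E : (PairIdx n → ℝ) ≃ₗ[ℝ] (PairIdx n → ℝ) :=
    LinearEquiv.piCongrRight fun p => LinearEquiv.smulOfNeZero ℝ ℝ (κ p) (hκ0 p)
  have hE : ∀ c p, E c p = κ p * c p := fun c p => rfl
  refine ⟨(LinearMap.ker (eqMap z)).comap (E : (PairIdx n → ℝ) →ₗ[ℝ] (PairIdx n → ℝ)), ?_, ?_⟩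
  · ext c
    simp only [SetLike.mem_coe, Submodule.mem_comap, LinearMap.mem_ker, LinearEquiv.coe_coe]
    rw [eqMap_ker_iff hz.1]
    refine forall_congr' fun k => ?_
    have hk : ((k:ℂ)+1) * (k+2) ≠ 0 := mul_ne_zero (by exact_mod_cast Nat.succ_ne_zero k)
      (by exact_mod_cast Nat.succ_ne_zero (k+1))
    have hsum : ∑ p : PairIdx n, (E c p : ℂ) *
      (((z p.1.1 ^ (k+2) - z 0 ^ (k+2)) / (z p.1.1 - z 0)
        - (z p.1.2 ^ (k+2) - z 0 ^ (k+2)) / (z p.1.2 - z 0)) / (z p.1.1 - z p.1.2)) =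
        ((k:ℂ)+1) * (k+2) * ∑ p : PairIdx n,
            (c p : ℂ) * ∫ w in convexHull ℝ ({z 0, z p.1.1, z p.1.2} : Set ℂ), w ^ k := by
      rw [Finset.mul_sum]
      refine Finset.sum_congr rfl fun p _ => ?_
      rw [hE, mul_left_comm, hκ p k]
      push_cast; ring
    rw [hsum]
    exact ⟨fun h => (mul_eq_zero.1 h).resolve_left hk, fun h => by rw [h, mul_zero]⟩
  · rw [← finrank_ker hz hn]
    exact (E.ofSubmodule' _).finrank_eq
end

section
/- Let n ≥ 3 and let z_1, …, z_n ∈ ℂ, with z_i = x_i + y_i·I. For a pair (i,j) with 1 ≤ i < j ≤ n, write ∏_{k ∈ {1,…,n}, k ∉ {i,j}} (1 − z_k·u) = Σ_{r=0}^{n−2} c_r^{(i,j)} u^r (so c_0^{(i,j)} = 1). Let M be the (2n−3)×(2n−3) real matrix whose columns are indexed, in order, by the pairs (1,2),(1,3),…,(1,n),(2,3),(2,4),…,(2,n), the column for (i,j) being (1, Re c_1^{(i,j)}, Im c_1^{(i,j)}, Re c_2^{(i,j)}, Im c_2^{(i,j)}, …, Re c_{n−2}^{(i,j)}, Im c_{n−2}^{(i,j)})ᵀ.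 Then there exists a nonzero real constant C, depending only on n, such that det M = C · (∏_{k=3}^{n} [12k]) · ∏_{3 ≤ i < j ≤ n} ‖z_i − z_j‖². In particular, if the z_i are pairwise distinct and no three of the points z_1,…,z_n are collinear, then M is invertible. -/
open Polynomial

/-- Twice the signed area `[abc]` of the triangle with vertices `a, b, c ∈ ℂ`:
`(x_b−x_a)(y_c−y_a) − (x_c−x_a)(y_b−y_a)`. -/
def br (a b c : ℂ) : ℝ :=
  (b - a).re * (c - a).im - (c - a).re * (b - a).im

/-- The pair `(i, j)` indexing the `j`-th column of the matrix `M` below: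
the columns are, in order, `(1,2), (1,3), …, (1,n), (2,3), (2,4), …, (2,n)`. -/
def colPair (n : ℕ) (j : ℕ) : ℕ × ℕ :=
  if j < n - 1 then (1, j + 2) else (2, j - (n - 1) + 3)

/-- The product `∏_{k ∈ {1,…,n} \ {i,j}} (1 - z_k u)` whose coefficients
`c_r^{(i,j)}` fill the column of `M` indexed by the pair `(i,j)`. -/
noncomputable def colPoly (n : ℕ) (z : ℕ → ℂ) (p : ℕ × ℕ) : Polynomial ℂ :=
  ∏ k ∈ ((Finset.Icc 1 n).erase p.1).erase p.2, (1 - Polynomial.C (z k) * Polynomial.X)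

/-- The `(2n-3) × (2n-3)` real matrix `M`: its column indexed by the pair `(i,j)` is
`(1, Re c_1^{(i,j)}, Im c_1^{(i,j)}, …, Re c_{n-2}^{(i,j)}, Im c_{n-2}^{(i,j)})ᵀ`. -/
noncomputable def realMomentMatrix (n : ℕ) (z : ℕ → ℂ) :
    Matrix (Fin (2 * n - 3)) (Fin (2 * n - 3)) ℝ :=
  Matrix.of fun r j =>
    if (r : ℕ) = 0 then 1
    else if (r : ℕ) % 2 = 1 then
      ((colPoly n z (colPair n (j : ℕ))).coeff (((r : ℕ) + 1) / 2)).re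
    else
      ((colPoly n z (colPair n (j : ℕ))).coeff ((r : ℕ) / 2)).im

namespace RealMoment

open Finset Matrix

/-- The product of `1 - w k X` over all `k ≠ j`. -/
noncomputable def Pj {m : ℕ} (w : Fin m → ℂ) (j : Fin m) : ℂ[X] :=
  ∏ k ∈ univ.erase j, (1 - C (w k) * X)

/-- Complex coefficient matrix of the `Pj`. -/
noncomputable def E {m : ℕ} (w : Fin m → ℂ) : Matrix (Fin m) (Fin m) ℂ :=
  Matrix.of fun s j => (Pj w j).coeff s

lemma natDegree_le {m : ℕ} (w : Fin m → ℂ) (S : Finset (Fin m)) :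
    (∏ k ∈ S, (1 - C (w k) * X) : ℂ[X]).natDegree ≤ #S := by
  refine (natDegree_prod_le _ _).trans ?_
  calc _ ≤ ∑ k ∈ S, 1 := Finset.sum_le_sum fun k _ => by compute_degree
    _ = _ := by simp

lemma sum_coeff {m : ℕ} (w : Fin m → ℂ) (S : Finset (Fin m)) (x : ℂ) :
    ∑ s ∈ range (#S + 1), x ^ (#S - s) * (∏ k ∈ S, (1 - C (w k) * X) : ℂ[X]).coeff s
      = ∏ k ∈ S, (x - w k) := by
  by_cases hx : x = 0
  · subst hx
    rw [Finset.sum_eq_single #S]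
    · have := coeff_prod_of_natDegree_le (s := S) (fun k => (1 - C (w k) * X : ℂ[X])) 1
        (fun k _ => by compute_degree)
      rw [mul_one] at this
      rw [this]
      simp [coeff_one]
    · intro s hs hne
      rw [Finset.mem_range] at hs
      rw [zero_pow (by omega), zero_mul]
    · simp
  · have h := eval_eq_sum_range' (Nat.lt_succ_of_le (natDegree_le w S)) (x⁻¹)
    rw [eval_prod] at h
    have h2 : ∏ k ∈ S, (x - w k) = x ^ #S * ∏ k ∈ S, eval x⁻¹ (1 - C (w k) * X) := by
      rw [← Finset.prod_const, ← Finset.prod_mul_distrib]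
      refine Finset.prod_congr rfl fun k _ => ?_
      simp
      field_simp
    rw [h2, h, Finset.mul_sum]
    refine Finset.sum_congr rfl fun s hs => ?_
    rw [Finset.mem_range] at hs
    have : x ^ #S = x ^ (#S - s) * x ^ s := by rw [← pow_add]; congr 1; omega
    rw [this, inv_pow]
    field_simp

lemma vand_mul {m : ℕ} (w : Fin m → ℂ) :
    projVandermonde 1 w * E w = diagonal fun j => ∏ k ∈ univ.erase j, (w j - w k) := by
  ext i j
  have hm : 0 < m := j.pos
  have hc : #(univ.erase j) = m - 1 := by simp
  have h := sum_coeff w (univ.erase j) (w i)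
  rw [hc, Nat.sub_add_cancel hm, Finset.sum_range] at h
  rw [Matrix.mul_apply]
  have : ∑ s, projVandermonde 1 w i s * E w s j = ∏ k ∈ univ.erase j, (w i - w k) := by
    rw [← h]
    refine Finset.sum_congr rfl fun s _ => ?_
    simp only [projVandermonde_apply, E, Pj, Matrix.of_apply, Pi.one_apply, one_pow, one_mul,
      Fin.val_rev]
    congr 2
    omega
  rw [this, Matrix.diagonal_apply]
  split_ifs with hij
  · rw [hij]
  · exact Finset.prod_eq_zero (Finset.mem_erase.2 ⟨hij, mem_univ i⟩) (sub_self _)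

/-- product of squared distances -/
noncomputable def disc {m : ℕ} (w : Fin m → ℂ) : ℝ :=
  ∏ i, ∏ j ∈ Ioi i, Complex.normSq (w i - w j)

lemma prod_erase_eq {m : ℕ} (w : Fin m → ℂ) :
    ∏ j, ∏ k ∈ univ.erase j, Complex.normSq (w j - w k) = disc w * disc w := by
  have h1 : ∀ j : Fin m, ∏ k ∈ univ.erase j, Complex.normSq (w j - w k) =
      (∏ k ∈ Ioi j, Complex.normSq (w j - w k)) * ∏ k ∈ Iio j, Complex.normSq (w j - w k) := by
    intro j
    rw [← Finset.prod_union]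
    · refine Finset.prod_congr ?_ fun _ _ => rfl
      ext k
      simp only [Finset.mem_erase, Finset.mem_union, Finset.mem_Ioi, Finset.mem_Iio,
        Finset.mem_univ, and_true]
      exact ⟨fun h => (lt_or_gt_of_ne h).symm, fun h => h.elim ne_of_gt ne_of_lt⟩
    · rw [Finset.disjoint_left]
      intro k hk hk'
      rw [Finset.mem_Ioi] at hk
      rw [Finset.mem_Iio] at hk'
      exact lt_asymm hk hk'
  simp_rw [h1]
  rw [Finset.prod_mul_distrib]
  congr 1
  rw [disc]
  rw [Finset.prod_comm' (t' := univ) (s' := fun k => Ioi k)]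
  · refine Finset.prod_congr rfl fun i _ => Finset.prod_congr rfl fun j _ => ?_
    rw [← Complex.normSq_neg, neg_sub]
  · simp

lemma normSq_det_E {m : ℕ} (w : Fin m → ℂ) : Complex.normSq (E w).det = disc w := by
  by_cases hw : Function.Injective w
  · have h := congrArg (fun A => Complex.normSq (Matrix.det A)) (vand_mul w)
    simp only [Matrix.det_mul, det_projVandermonde, Matrix.det_diagonal, map_mul, map_prod,
      Pi.one_apply, one_mul] at h
    rw [prod_erase_eq] at h
    change disc w * _ = _ at h
    refine mul_left_cancel₀ ?_ h
    refine Finset.prod_ne_zero_iff.2 fun i _ => Finset.prod_ne_zero_iff.2 fun j hj => ?_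
    rw [Ne, Complex.normSq_eq_zero, sub_eq_zero]
    exact fun h => (Finset.mem_Ioi.1 hj).ne (hw h)
  · have : ∃ i j, w i = w j ∧ i < j := by
      simp only [Function.Injective] at hw
      push Not at hw
      obtain ⟨i, j, h, hne⟩ := hw
      rcases lt_or_gt_of_ne hne with h' | h'
      · exact ⟨i, j, h, h'⟩
      · exact ⟨j, i, h.symm, h'⟩
    obtain ⟨i, j, h, hlt⟩ := this
    have h0 : disc w = 0 := Finset.prod_eq_zero (mem_univ i)
      (Finset.prod_eq_zero (Finset.mem_Ioi.2 hlt) (by simp [h]))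
    rw [h0, Matrix.det_zero_of_column_eq hlt.ne, map_zero]
    intro s
    have hP : Pj w i = Pj w j := by
      have h1 := Finset.mul_prod_erase univ (fun k => (1 - C (w k) * X : ℂ[X])) (mem_univ i)
      have h2 := Finset.mul_prod_erase univ (fun k => (1 - C (w k) * X : ℂ[X])) (mem_univ j)
      have h3 := h1.trans h2.symm
      simp only [h] at h3
      refine mul_left_cancel₀ ?_ h3
      intro h4
      have := congrArg (eval 0) h4
      simp at this
    simp [E, hP]

/-- Real form of `E`. -/
noncomputable def Q {m : ℕ} (w : Fin m → ℂ) : Matrix (Fin m × Fin 2) (Fin m × Fin 2) ℝ :=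
  ((E w).map (Algebra.leftMulMatrix Complex.basisOneI)).comp _ _ _ _ _

lemma det_Q {m : ℕ} (w : Fin m → ℂ) : (Q w).det = disc w := by
  have := Matrix.det_det (E w) (Algebra.leftMulMatrix Complex.basisOneI).toRingHom
  rw [← normSq_det_E]
  refine Eq.trans this.symm ?_
  change (Algebra.leftMulMatrix Complex.basisOneI (E w).det).det = _
  rw [Algebra.leftMulMatrix_complex, Matrix.det_fin_two_of, Complex.normSq_apply]
  ring

/-- The 2 by 2 block. -/
def blk (a b c : ℂ) : Matrix (Fin 2) (Fin 2) ℝ :=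
  !![(c - b).re, (c - a).re; (c - b).im, (c - a).im]

lemma det_blk (a b c : ℂ) : (blk a b c).det = - br a b c := by
  rw [blk, Matrix.det_fin_two_of, br]
  simp only [Complex.sub_re, Complex.sub_im]
  ring

/-- block diagonal matrix -/
def D {m : ℕ} (a b : ℂ) (w : Fin m → ℂ) : Matrix (Fin m × Fin 2) (Fin m × Fin 2) ℝ :=
  (blockDiagonal fun j => blk a b (w j)).submatrix (Equiv.prodComm _ _) (Equiv.prodComm _ _)

lemma det_D {m : ℕ} (a b : ℂ) (w : Fin m → ℂ) :
    (D a b w).det = (-1) ^ m * ∏ j, br a b (w j) := by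
  rw [D, Matrix.det_submatrix_equiv_self, Matrix.det_blockDiagonal]
  simp_rw [det_blk]
  rw [Finset.prod_neg]
  simp

/-- real or imaginary part -/
def part (t : Fin 2) (z : ℂ) : ℝ := ![z.re, z.im] t

lemma QD_apply {m : ℕ} (a b : ℂ) (w : Fin m → ℂ) (s j : Fin m) (t t' : Fin 2) :
    (Q w * D a b w) (s, t) (j, t') = part t ((w j - ![b, a] t') * (Pj w j).coeff s) := by
  rw [Matrix.mul_apply, Fintype.sum_prod_type, Finset.sum_eq_single j]
  · simp only [Q, D, Matrix.comp_apply, Matrix.map_apply, Algebra.leftMulMatrix_complex,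
      Matrix.submatrix_apply, Equiv.prodComm_apply, Prod.swap_prod_mk,
      Matrix.blockDiagonal_apply_eq, blk, E, Matrix.of_apply]
    fin_cases t <;> fin_cases t' <;> simp [part] <;> ring
  · intro i _ hne
    refine Finset.sum_eq_zero fun x _ => ?_
    simp [D, Matrix.blockDiagonal_apply_ne _ _ _ hne]
  · simp

/-- Column polynomials -/
noncomputable def col {m : ℕ} (a b : ℂ) (w : Fin m → ℂ) : Unit ⊕ Fin m × Fin 2 → ℂ[X]
  | .inl _ => ∏ k, (1 - C (w k) * X)
  | .inr (j, t) => (1 - C (![b, a] t) * X) * Pj w j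

/-- The rearranged matrix -/
noncomputable def N {m : ℕ} (a b : ℂ) (w : Fin m → ℂ) :
    Matrix (Unit ⊕ Fin m × Fin 2) (Unit ⊕ Fin m × Fin 2) ℝ :=
  Matrix.of fun r c => match r with
    | .inl _ => 1
    | .inr (s, t) => part t ((col a b w c).coeff (s + 1))

lemma col_inr {m : ℕ} (a b : ℂ) (w : Fin m → ℂ) (j : Fin m) (t : Fin 2) :
    col a b w (.inr (j, t)) = col a b w (.inl ()) + C (w j - ![b, a] t) * Pj w j * X := by
  simp only [col]
  rw [← Finset.mul_prod_erase univ _ (mem_univ j), ← Pj, C_sub]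
  ring

lemma part_add (t : Fin 2) (x y : ℂ) : part t (x + y) = part t x + part t y := by
  fin_cases t <;> simp [part]

lemma N_eq {m : ℕ} (a b : ℂ) (w : Fin m → ℂ) :
    N a b w = fromBlocks (1 : Matrix Unit Unit ℝ) 0
        (Matrix.of fun r _ => part r.2 ((col a b w (.inl ())).coeff (r.1 + 1))) (Q w) *
      fromBlocks 1 (Matrix.of fun _ _ => 1) 0 (D a b w) := by
  rw [Matrix.fromBlocks_multiply]
  ext r c
  rcases r with r | ⟨s, t⟩ <;> rcases c with c | ⟨j, t'⟩
  · simp [N]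
  · simp [N]
  · simp [N]
  · simp only [N, Matrix.of_apply, fromBlocks_apply₂₂, Matrix.add_apply, QD_apply, col_inr]
    rw [coeff_add, coeff_mul_X, coeff_C_mul, part_add]
    simp [Matrix.mul_apply]

lemma det_N {m : ℕ} (a b : ℂ) (w : Fin m → ℂ) :
    (N a b w).det = (-1) ^ m * (∏ j, br a b (w j)) * disc w := by
  rw [N_eq, Matrix.det_mul, Matrix.det_fromBlocks_zero₁₂, Matrix.det_fromBlocks_zero₂₁, det_Q,
    det_D]
  simp
  ring

/-- row index -/
def rowIdx (m : ℕ) (hm : 1 ≤ m) : Unit ⊕ Fin m × Fin 2 → Fin (2 * (m + 2) - 3)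
  | .inl _ => ⟨0, by omega⟩
  | .inr (s, t) => ⟨1 + 2 * s + t, by omega⟩

/-- column index -/
def colIdx (m : ℕ) (hm : 1 ≤ m) : Unit ⊕ Fin m × Fin 2 → Fin (2 * (m + 2) - 3)
  | .inl _ => ⟨0, by omega⟩
  | .inr (s, t) => ⟨1 + s + t * m, by
      have := s.2
      fin_cases t <;> simp <;> omega⟩

lemma row_bij (m : ℕ) (hm : 1 ≤ m) : Function.Bijective (rowIdx m hm) := by
  rw [Fintype.bijective_iff_injective_and_card]
  constructor
  · rintro (r | ⟨s, t⟩) (r' | ⟨s', t'⟩) h <;> simp [rowIdx] at h ⊢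
    omega
  · simp; omega

lemma col_bij (m : ℕ) (hm : 1 ≤ m) : Function.Bijective (colIdx m hm) := by
  rw [Fintype.bijective_iff_injective_and_card]
  constructor
  · rintro (r | ⟨s, t⟩) (r' | ⟨s', t'⟩) h <;> simp [colIdx] at h ⊢
    have h1 := s.2
    have h2 := s'.2
    fin_cases t <;> fin_cases t' <;> simp [Fin.ext_iff] at h ⊢ <;> omega
  · simp; omega

lemma colPoly_eq (m : ℕ) (hm : 1 ≤ m) (z : ℕ → ℂ) (c : Unit ⊕ Fin m × Fin 2) :
    colPoly (m + 2) z (colPair (m + 2) (colIdx m hm c)) =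
      col (z 1) (z 2) (fun i : Fin m => z (i + 3)) c := by
  have key : ∀ (j : Fin m), ∏ k ∈ ((Icc 3 (m + 2)).erase (j + 3)), (1 - C (z k) * X) =
      Pj (fun i : Fin m => z (i + 3)) j := by
    intro j
    rw [Pj]
    symm
    refine Finset.prod_bij (fun i _ => (i : ℕ) + 3) ?_ ?_ ?_ ?_
    · intro i hi
      have := i.2
      simp [Fin.ext_iff] at hi ⊢
      omega
    · intro i _ i' _ h
      ext; omega
    · intro k hk
      simp at hk
      refine ⟨⟨k - 3, by omega⟩, ?_, ?_⟩
      · simp [Fin.ext_iff]; omega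
      · simp; omega
    · intros; rfl
  rcases c with c | ⟨j, t⟩
  · have hp : colPair (m + 2) (colIdx m hm (.inl c)) = (1, 2) := by
      simp [colIdx, colPair]
    rw [hp]
    simp only [col, colPoly]
    symm
    refine Finset.prod_bij (fun i _ => (i : ℕ) + 3) ?_ ?_ ?_ ?_
    · intro i hi
      have := i.2
      simp
    · intro i _ i' _ h
      ext; omega
    · intro k hk
      simp at hk
      refine ⟨⟨k - 3, by omega⟩, mem_univ _, ?_⟩
      show k - 3 + 3 = k
      exact Nat.sub_add_cancel (by omega)
    · intros; rfl
  · have hj := j.2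
    have hp : colPair (m + 2) (colIdx m hm (.inr (j, t))) = ((t : ℕ) + 1, (j : ℕ) + 3) := by
      simp only [colIdx, colPair]
      fin_cases t
      · have h1 : 1 + (j : ℕ) + 0 * m < m + 2 - 1 := by omega
        have h2 : 1 + (j : ℕ) + 0 * m + 2 = j + 3 := by omega
        exact (if_pos h1).trans (by rw [h2])
      · have h1 : ¬ (1 + (j : ℕ) + 1 * m < m + 2 - 1) := by omega
        have h2 : 1 + (j : ℕ) + 1 * m - (m + 2 - 1) + 3 = j + 3 := by omega
        exact (if_neg h1).trans (by rw [h2])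
    rw [hp]
    simp only [colPoly, col]
    rw [← key]
    fin_cases t
    · change ∏ k ∈ ((Icc 1 (m + 2)).erase 1).erase ((j : ℕ) + 3), (1 - C (z k) * X) =
        (1 - C (z 2) * X) * ∏ k ∈ (Icc 3 (m + 2)).erase ((j : ℕ) + 3), (1 - C (z k) * X)
      rw [← Finset.prod_insert (s := (Icc 3 (m + 2)).erase ((j : ℕ) + 3)) (a := 2)
        (f := fun k => (1 - C (z k) * X : ℂ[X])) (by simp)]
      refine Finset.prod_congr ?_ fun _ _ => rfl
      ext k
      simp
      omega
    · change ∏ k ∈ ((Icc 1 (m + 2)).erase 2).erase ((j : ℕ) + 3), (1 - C (z k) * X) =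
        (1 - C (z 1) * X) * ∏ k ∈ (Icc 3 (m + 2)).erase ((j : ℕ) + 3), (1 - C (z k) * X)
      rw [← Finset.prod_insert (s := (Icc 3 (m + 2)).erase ((j : ℕ) + 3)) (a := 1)
        (f := fun k => (1 - C (z k) * X : ℂ[X])) (by simp)]
      refine Finset.prod_congr ?_ fun _ _ => rfl
      ext k
      simp
      omega

lemma submatrix_eq (m : ℕ) (hm : 1 ≤ m) (z : ℕ → ℂ) :
    (realMomentMatrix (m + 2) z).submatrix (rowIdx m hm) (colIdx m hm) =
      N (z 1) (z 2) (fun i : Fin m => z (i + 3)) := by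
  ext r c
  simp only [Matrix.submatrix_apply, realMomentMatrix, Matrix.of_apply, colPoly_eq, N]
  rcases r with r | ⟨s, t⟩
  · simp [rowIdx]
  · simp only [rowIdx]
    fin_cases t
    · have h1 : (1 + 2 * (s : ℕ) + 0 + 1) / 2 = s + 1 := by omega
      have h2 : (1 + 2 * (s : ℕ)) % 2 = 1 := by omega
      simp [part, h2]
      congr 2
    · have h2 : (1 + 2 * (s : ℕ) + 1) % 2 = 0 := by omega
      simp [part, h2]
      congr 2
      omega

lemma det_eq (m : ℕ) (hm : 1 ≤ m) : ∃ C : ℝ, C ≠ 0 ∧ ∀ z : ℕ → ℂ,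
    (realMomentMatrix (m + 2) z).det =
      C * (∏ j : Fin m, br (z 1) (z 2) (z (j + 3))) * disc (fun i : Fin m => z (i + 3)) := by
  let er := Equiv.ofBijective _ (row_bij m hm)
  let ec := Equiv.ofBijective _ (col_bij m hm)
  let σ := er.symm.trans ec
  refine ⟨((Equiv.Perm.sign σ : ℤ) : ℝ) * (-1) ^ m, ?_, fun z => ?_⟩
  · rcases Int.units_eq_one_or (Equiv.Perm.sign σ) with h | h <;> simp [h]
  · have h := Matrix.det_permute' σ (realMomentMatrix (m + 2) z)
    have h2 : ((realMomentMatrix (m + 2) z).submatrix id σ).det =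
        (N (z 1) (z 2) (fun i : Fin m => z (i + 3))).det := by
      rw [← submatrix_eq m hm, ← Matrix.det_submatrix_equiv_self er, Matrix.submatrix_submatrix]
      congr 2
      ext x
      simp [σ, er, ec]
    rw [h2, det_N] at h
    rw [mul_assoc (_ * _), mul_assoc ((Equiv.Perm.sign σ : ℤ) : ℝ), ← mul_assoc (_ ^ m), h,
      ← mul_assoc, ← Int.cast_mul, ← Units.val_mul, Int.units_mul_self]
    simp

lemma prod_br_eq (m : ℕ) (f : ℕ → ℝ) : ∏ k ∈ Icc 3 (m + 2), f k = ∏ j : Fin m, f (j + 3) := by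
  rw [Fin.prod_univ_eq_prod_range (fun j => f (j + 3)) m]
  symm
  refine Finset.prod_bij (fun i _ => i + 3) ?_ ?_ ?_ ?_
  · intro i hi
    simp at hi ⊢
    omega
  · intro i _ i' _ h
    omega
  · intro k hk
    simp at hk
    exact ⟨k - 3, by simp; omega, by omega⟩
  · intros; rfl

lemma disc_eq (m : ℕ) (z : ℕ → ℂ) :
    ∏ p ∈ (Icc 3 (m + 2) ×ˢ Icc 3 (m + 2)).filter (fun p => p.1 < p.2),
      Complex.normSq (z p.1 - z p.2) = disc (fun i : Fin m => z (i + 3)) := by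
  rw [disc, Finset.prod_sigma']
  symm
  refine Finset.prod_bij (fun i _ => ((i.1 : ℕ) + 3, (i.2 : ℕ) + 3)) ?_ ?_ ?_ ?_
  · rintro ⟨i, j⟩ h
    have := i.2
    have := j.2
    simp at h ⊢
    omega
  · rintro ⟨i, j⟩ _ ⟨i', j'⟩ _ h
    simp [← Fin.ext_iff] at h ⊢
    exact h
  · rintro ⟨k, l⟩ h
    simp at h
    refine ⟨⟨⟨k - 3, by omega⟩, ⟨l - 3, by omega⟩⟩, ?_, ?_⟩
    · simp; omega
    · simp; omega
  · intros; rfl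

lemma collinear_of_br (a b c : ℂ) (hab : a ≠ b) (h : br a b c = 0) :
    Collinear ℝ ({a, b, c} : Set ℂ) := by
  rw [collinear_iff_of_mem (p₀ := a) (by simp)]
  have hn : Complex.normSq (b - a) ≠ 0 := by
    rw [Ne, Complex.normSq_eq_zero, sub_eq_zero]
    exact hab.symm
  refine ⟨b - a, ?_⟩
  intro p hp
  simp only [Set.mem_insert_iff, Set.mem_singleton_iff] at hp
  rcases hp with rfl | rfl | rfl
  · exact ⟨0, by simp⟩
  · exact ⟨1, by simp⟩
  · refine ⟨((p - a).re * (b - a).re + (p - a).im * (b - a).im) / Complex.normSq (b - a), ?_⟩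
    rw [vadd_eq_add, ← sub_eq_iff_eq_add]
    rw [br] at h
    rw [Complex.normSq_apply] at hn ⊢
    generalize p - a = u at *
    generalize b - a = v at *
    apply Complex.ext
    · simp only [Complex.real_smul, Complex.re_ofReal_mul]
      rw [div_mul_eq_mul_div, eq_div_iff hn]
      linear_combination (-v.im) * h
    · simp only [Complex.real_smul, Complex.im_ofReal_mul]
      rw [div_mul_eq_mul_div, eq_div_iff hn]
      linear_combination v.re * h

end RealMoment

/-- For `n ≥ 3` there is a nonzero real constant `C`, depending only on
`n`, such that for all `z_1, …, z_n ∈ ℂ`,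
`det M = C · (∏_{k=3}^n [12k]) · ∏_{3 ≤ i < j ≤ n} ‖z_i − z_j‖²`. In particular, if the
points are pairwise distinct and no three of them are collinear, `M` is invertible. -/
theorem det_real_moment_matrix (n : ℕ) (hn : 3 ≤ n) :
    ∃ C : ℝ, C ≠ 0 ∧
      (∀ z : ℕ → ℂ,
        (realMomentMatrix n z).det =
          C * (∏ k ∈ Finset.Icc 3 n, br (z 1) (z 2) (z k)) *
            ∏ p ∈ (Finset.Icc 3 n ×ˢ Finset.Icc 3 n).filter (fun p => p.1 < p.2),
              Complex.normSq (z p.1 - z p.2)) ∧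
      (∀ z : ℕ → ℂ,
        Set.InjOn z (Finset.Icc 1 n) →
        (∀ i ∈ Finset.Icc 1 n, ∀ j ∈ Finset.Icc 1 n, ∀ k ∈ Finset.Icc 1 n,
          i ≠ j → i ≠ k → j ≠ k → ¬Collinear ℝ ({z i, z j, z k} : Set ℂ)) →
        IsUnit (realMomentMatrix n z).det) := by
  obtain ⟨m, rfl⟩ : ∃ m, n = m + 2 := ⟨n - 2, by omega⟩
  obtain ⟨C, hC, h⟩ := RealMoment.det_eq m (by omega)
  have h' : ∀ z : ℕ → ℂ,
        (realMomentMatrix (m + 2) z).det =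
          C * (∏ k ∈ Finset.Icc 3 (m + 2), br (z 1) (z 2) (z k)) *
            ∏ p ∈ (Finset.Icc 3 (m + 2) ×ˢ Finset.Icc 3 (m + 2)).filter (fun p => p.1 < p.2),
              Complex.normSq (z p.1 - z p.2) := by
    intro z
    rw [h, RealMoment.disc_eq, RealMoment.prod_br_eq m (fun k => br (z 1) (z 2) (z k))]
  refine ⟨C, hC, h', fun z hz hcol => ?_⟩
  rw [h', isUnit_iff_ne_zero]
  refine mul_ne_zero (mul_ne_zero hC ?_) ?_
  · refine Finset.prod_ne_zero_iff.2 fun k hk hbr => ?_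
    rw [Finset.mem_Icc] at hk
    refine hcol 1 (by simp) 2 (by simp) k (by simp; omega) (by omega) (by omega) (by omega) ?_
    refine RealMoment.collinear_of_br _ _ _ (fun h12 => ?_) hbr
    have := hz (by simp) (by simp) h12
    omega
  · refine Finset.prod_ne_zero_iff.2 fun p hp => ?_
    simp only [Finset.mem_filter, Finset.mem_product, Finset.mem_Icc] at hp
    rw [Ne, Complex.normSq_eq_zero, sub_eq_zero]
    intro hh
    have := hz (by simp; omega) (by simp; omega) hh
    omega
end
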